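/- arXiv:2602.02470 — 3 statements merged into one kernel-verified Lean document; each statement's English description precedes it below -/
import Mathlib

section
/- The multiset of eigenvalues of the 2N×2N real symmetric matrix W·Wᵀ consists of λ₁⁺ and λ₁⁻, each with multiplicity one, together with λ₂⁺ and λ₂⁻, each with multiplicity N−1, where λ₁^± = ((C_{A1} + N·C_{A2} + C_{D1} + N·C_{D2}) ± √((C_{A1} + N·C_{A2} − C_{D1} − N·C_{D2})² + 4(C_{B1} + N·C_{B2})²))/2 and λ₂^± = ((C_{A1} + C_{D1}) ± √((C_{A1} − C_{D1})² + 4·C_{B1}²))/2. -/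
open Matrix

/-- Row index of the `a`-block in `Fin (2N)`. -/
def aRow (N : ℕ) (i : Fin N) : Fin (2 * N) := ⟨i, by have := i.isLt; omega⟩

/-- Row index of the `b`-block in `Fin (2N)`. -/
def bRow (N : ℕ) (i : Fin N) : Fin (2 * N) := ⟨N + i, by have := i.isLt; omega⟩

/-- Column index of the `a`-block in `Fin (2N+1)`. -/
def aCol (N : ℕ) (j : Fin N) : Fin (2 * N + 1) := ⟨j, by have := j.isLt; omega⟩

/-- Column index of the `b`-block in `Fin (2N+1)`. -/
def bCol (N : ℕ) (j : Fin N) : Fin (2 * N + 1) := ⟨N + j, by have := j.isLt; omega⟩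

/-- The last column index in `Fin (2N+1)`. -/
def rCol (N : ℕ) : Fin (2 * N + 1) := ⟨2 * N, by omega⟩

open Polynomial in
/-- The determinant of a scalar matrix plus a multiple of the all-ones matrix. -/
theorem det_smul_one_add_smul_ones {n : ℕ} (hn : 1 ≤ n) (a b : ℝ) :
    (a • (1 : Matrix (Fin n) (Fin n) ℝ) + b • Matrix.of fun _ _ => 1).det =
      a ^ (n - 1) * (a + n * b) := by
  have h := congrArg (eval a) (charpoly_vecMulVec (fun _ : Fin n => -b) fun _ => (1 : ℝ))
  rw [eval_charpoly] at h
  have hM : a • (1 : Matrix (Fin n) (Fin n) ℝ) + b • Matrix.of (fun _ _ => 1) =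
      scalar (Fin n) a - vecMulVec (fun _ => -b) fun _ => (1 : ℝ) := by
    ext i j
    simp [vecMulVec_apply, smul_one_eq_diagonal]
  obtain ⟨k, rfl⟩ := Nat.exists_eq_add_of_le' hn
  rw [hM, h]
  simp [dotProduct]
  ring

open Polynomial in
/-- The determinant of a `2 × 2` block matrix whose blocks are linear combinations of the identity
and the all-ones matrix. -/
theorem det_comp_smul_one_add_smul_ones {n : ℕ} (hn : 1 ≤ n) (x y : Matrix (Fin 2) (Fin 2) ℝ)
    (M : Matrix (Fin 2 × Fin n) (Fin 2 × Fin n) ℝ)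
    (hM : ∀ p q, M p q = (if p.2 = q.2 then x p.1 q.1 else 0) + y p.1 q.1) :
    M.det = x.det ^ (n - 1) * (x + (n : ℝ) • y).det := by
  set J : Matrix (Fin n) (Fin n) ℝ := Matrix.of fun _ _ => 1 with hJ
  have hJJ : J * J = (n : ℝ) • J := by
    ext i j
    simp [hJ, Matrix.mul_apply]
  have h := det_det (Matrix.of fun i j => C (x i j) + C (y i j) * X : Matrix (Fin 2) (Fin 2) ℝ[X])
    (aeval J : ℝ[X] →ₐ[ℝ] Matrix (Fin n) (Fin n) ℝ).toRingHom
  have hcomp : M = comp (Fin 2) (Fin 2) (Fin n) (Fin n) ℝ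
      ((Matrix.of fun i j => C (x i j) + C (y i j) * X).map
        (aeval J : ℝ[X] →ₐ[ℝ] Matrix (Fin n) (Fin n) ℝ).toRingHom) := by
    ext ⟨i, k⟩ ⟨j, l⟩
    simp [hM, hJ, comp_apply, algebraMap_eq_diagonal, diagonal_apply]
  rw [hcomp, ← h]
  have hdet : (aeval J : ℝ[X] →ₐ[ℝ] Matrix (Fin n) (Fin n) ℝ).toRingHom
      (Matrix.of fun i j => C (x i j) + C (y i j) * X : Matrix (Fin 2) (Fin 2) ℝ[X]).det =
      x.det • 1 + (x 0 0 * y 1 1 + y 0 0 * x 1 1 - x 0 1 * y 1 0 - y 0 1 * x 1 0 +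
        n * y.det) • J := by
    simp only [det_fin_two, of_apply, AlgHom.toRingHom_eq_coe, RingHom.coe_coe, map_sub, map_mul,
      map_add, aeval_C, aeval_X, Algebra.algebraMap_eq_smul_one, add_mul, mul_add, smul_mul_assoc,
      mul_smul_comm, one_mul, mul_one, hJJ]
    module
  rw [hdet, hJ, det_smul_one_add_smul_ones hn]
  simp only [det_fin_two, Matrix.add_apply, Matrix.smul_apply, smul_eq_mul]
  ring

/-- The factorization of the characteristic polynomial of a symmetric `2 × 2` matrix. -/
theorem mul_sub_eq_sub_sqrt_mul (a b d t : ℝ) :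
    (t - a) * (t - d) - b ^ 2 =
      (t - ((a + d) + Real.sqrt ((a - d) ^ 2 + 4 * b ^ 2)) / 2) *
        (t - ((a + d) - Real.sqrt ((a - d) ^ 2 + 4 * b ^ 2)) / 2) := by
  have h := Real.sq_sqrt (show 0 ≤ (a - d) ^ 2 + 4 * b ^ 2 by positivity)
  linear_combination h / 4

/-- Under `finProdFinEquiv`, the first block of indices is `aRow`. -/
theorem finProdFinEquiv_zero_eq_aRow (N : ℕ) (i : Fin N) :
    finProdFinEquiv ((0 : Fin 2), i) = aRow N i := by
  ext; simp [aRow]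

/-- Under `finProdFinEquiv`, the second block of indices is `bRow`. -/
theorem finProdFinEquiv_one_eq_bRow (N : ℕ) (i : Fin N) :
    finProdFinEquiv ((1 : Fin 2), i) = bRow N i := by
  ext; simp [bRow, add_comm]

/-- A sum over all columns splits into the two column blocks and the last column. -/
theorem sum_columns (N : ℕ) (F : Fin (2 * N + 1) → ℝ) :
    ∑ k, F k = ∑ k, F (aCol N k) + ∑ k, F (bCol N k) + F (rCol N) := by
  rw [Fin.sum_univ_castSucc, ← (finProdFinEquiv (m := 2) (n := N)).sum_comp,
    Fintype.sum_prod_type, Fin.sum_univ_two]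
  simp only [finProdFinEquiv_zero_eq_aRow, finProdFinEquiv_one_eq_bRow]
  rfl

/-- The inner product of rows `i` and `j` of two matrices of the form `a • 1 + b • J`, where `J` is
the all-ones matrix. -/
theorem sum_ite_add_mul_ite_add {N : ℕ} (i j : Fin N) (a b c d : ℝ) :
    ∑ k, ((if i = k then a else 0) + b) * ((if j = k then c else 0) + d) =
      (if i = j then a * c else 0) + (a * d + b * c + N * b * d) := by
  simp only [add_mul, mul_add, Finset.sum_add_distrib, ite_mul, mul_ite, zero_mul, mul_zero,
    Finset.sum_ite_eq, Finset.mem_univ, if_true, Finset.sum_const, Finset.card_univ,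
    Fintype.card_fin, nsmul_eq_mul]
  ring

/-- For the symmetric block matrix `W`, the multiset of
eigenvalues of the `2N × 2N` real symmetric matrix `W·Wᵀ` consists of `λ₁⁺`
and `λ₁⁻` each with multiplicity one, together with `λ₂⁺` and `λ₂⁻` each with
multiplicity `N − 1`. -/
theorem eigenvalues_of_block_matrix (N : ℕ) (hN : 2 ≤ N)
    (f1 f2 g1 g2 l1 l2 m1 m2 β α : ℝ)
    (W : Matrix (Fin (2 * N)) (Fin (2 * N + 1)) ℝ)
    (hW : ∀ i j : Fin N,
      W (aRow N i) (aCol N j) = (if i = j then f1 else 0) + f2 ∧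
      W (aRow N i) (bCol N j) = (if i = j then g1 else 0) + g2 ∧
      W (aRow N i) (rCol N) = β ∧
      W (bRow N i) (aCol N j) = (if i = j then l1 else 0) + l2 ∧
      W (bRow N i) (bCol N j) = (if i = j then m1 else 0) + m2 ∧
      W (bRow N i) (rCol N) = α)
    (hHerm : (W * Wᵀ).IsHermitian) :
    Finset.univ.val.map hHerm.eigenvalues =
      (let CA1 : ℝ := f1 ^ 2 + g1 ^ 2
       let CA2 : ℝ := 2 * f1 * f2 + N * f2 ^ 2 + 2 * g1 * g2 + N * g2 ^ 2 + β ^ 2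
       let CD1 : ℝ := l1 ^ 2 + m1 ^ 2
       let CD2 : ℝ := 2 * l1 * l2 + N * l2 ^ 2 + 2 * m1 * m2 + N * m2 ^ 2 + α ^ 2
       let CB1 : ℝ := f1 * l1 + g1 * m1
       let CB2 : ℝ := f1 * l2 + f2 * l1 + N * f2 * l2 + g1 * m2 + g2 * m1 + N * g2 * m2 + β * α
       let lam1p : ℝ := ((CA1 + N * CA2 + CD1 + N * CD2) +
         Real.sqrt ((CA1 + N * CA2 - CD1 - N * CD2) ^ 2 + 4 * (CB1 + N * CB2) ^ 2)) / 2
       let lam1m : ℝ := ((CA1 + N * CA2 + CD1 + N * CD2) -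
         Real.sqrt ((CA1 + N * CA2 - CD1 - N * CD2) ^ 2 + 4 * (CB1 + N * CB2) ^ 2)) / 2
       let lam2p : ℝ := ((CA1 + CD1) + Real.sqrt ((CA1 - CD1) ^ 2 + 4 * CB1 ^ 2)) / 2
       let lam2m : ℝ := ((CA1 + CD1) - Real.sqrt ((CA1 - CD1) ^ 2 + 4 * CB1 ^ 2)) / 2
       lam1p ::ₘ lam1m ::ₘ
         (Multiset.replicate (N - 1) lam2p + Multiset.replicate (N - 1) lam2m)) := by
  extract_lets CA1 CA2 CD1 CD2 CB1 CB2 lam1p lam1m lam2p lam2m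
  have hroots := hHerm.roots_charpoly_eq_eigenvalues
  have hchar : (W * Wᵀ).charpoly = ((lam1p ::ₘ lam1m ::ₘ
      (Multiset.replicate (N - 1) lam2p + Multiset.replicate (N - 1) lam2m)).map
        fun r => Polynomial.X - Polynomial.C r).prod := by
    refine Polynomial.funext fun t => ?_
    rw [eval_charpoly, ← det_submatrix_equiv_self (finProdFinEquiv (m := 2) (n := N)),
      det_comp_smul_one_add_smul_ones (by omega) !![t - CA1, -CB1; -CB1, t - CD1]
        !![-CA2, -CB2; -CB2, -CD2]]
    · have h1 := mul_sub_eq_sub_sqrt_mul (CA1 + N * CA2) (CB1 + N * CB2) (CD1 + N * CD2) t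
      have h2 := mul_sub_eq_sub_sqrt_mul CA1 CB1 CD1 t
      have e1 : (CA1 + N * CA2) + (CD1 + N * CD2) = CA1 + N * CA2 + CD1 + N * CD2 := by ring
      have e2 : (CA1 + N * CA2) - (CD1 + N * CD2) = CA1 + N * CA2 - CD1 - N * CD2 := by ring
      rw [e1, e2] at h1
      have d1 : (!![t - CA1, -CB1; -CB1, t - CD1] + (N : ℝ) • !![-CA2, -CB2; -CB2, -CD2]).det =
          (t - lam1p) * (t - lam1m) := by
        refine Eq.trans ?_ h1
        simp only [det_fin_two, Matrix.add_apply, Matrix.smul_apply, smul_eq_mul, of_apply,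
          cons_val', cons_val_zero, cons_val_one, cons_val_fin_one]
        ring
      have d2 : (!![t - CA1, -CB1; -CB1, t - CD1]).det = (t - lam2p) * (t - lam2m) := by
        refine Eq.trans ?_ h2
        rw [det_fin_two_of]
        ring
      rw [d1, d2, mul_pow]
      simp only [Multiset.map_cons, Multiset.map_add, Multiset.map_replicate, Multiset.prod_cons,
        Multiset.prod_add, Multiset.prod_replicate, Polynomial.eval_mul, Polynomial.eval_pow,
        Polynomial.eval_sub, Polynomial.eval_X, Polynomial.eval_C]
      ring
    · have hentry : ∀ (i j : Fin N) (r s : Fin (2 * N)) (a b c d e a' b' c' d' e' : ℝ),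
          (∀ k, W r (aCol N k) = (if i = k then a else 0) + b) →
          (∀ k, W r (bCol N k) = (if i = k then c else 0) + d) → W r (rCol N) = e →
          (∀ k, W s (aCol N k) = (if j = k then a' else 0) + b') →
          (∀ k, W s (bCol N k) = (if j = k then c' else 0) + d') → W s (rCol N) = e' →
          (W * Wᵀ) r s = (if i = j then a * a' + c * c' else 0) +
            (a * b' + b * a' + N * b * b' + (c * d' + d * c' + N * d * d') + e * e') := by
        intro i j r s a b c d e a' b' c' d' e' h1 h2 h3 h4 h5 h6
        simp only [Matrix.mul_apply, transpose_apply, sum_columns, h1, h2, h3, h4, h5, h6,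
          sum_ite_add_mul_ite_add]
        split_ifs <;> ring
      have ha := fun i k => (hW i k).1
      have hb := fun i k => (hW i k).2.1
      have hr := fun i => (hW i i).2.2.1
      have hc := fun i k => (hW i k).2.2.2.1
      have hd := fun i k => (hW i k).2.2.2.2.1
      have hs := fun i => (hW i i).2.2.2.2.2
      rintro ⟨p, i⟩ ⟨q, j⟩
      simp only [submatrix_apply, Matrix.sub_apply, scalar_apply, diagonal_apply,
        EmbeddingLike.apply_eq_iff_eq, Prod.mk.injEq]
      fin_cases p <;> fin_cases q <;>
        simp only [Fin.zero_eta, Fin.mk_one, Fin.isValue, finProdFinEquiv_zero_eq_aRow,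
          finProdFinEquiv_one_eq_bRow, of_apply, cons_val', cons_val_zero, cons_val_one,
          cons_val_fin_one, true_and, zero_ne_one, one_ne_zero, false_and, if_false]
      · rw [hentry i j _ _ _ _ _ _ _ _ _ _ _ _ (ha i) (hb i) (hr i) (ha j) (hb j) (hr j)]
        simp only [CA1, CA2]
        split_ifs <;> ring
      · rw [hentry i j _ _ _ _ _ _ _ _ _ _ _ _ (ha i) (hb i) (hr i) (hc j) (hd j) (hs j)]
        simp only [CB1, CB2]
        split_ifs <;> ring
      · rw [hentry i j _ _ _ _ _ _ _ _ _ _ _ _ (hc i) (hd i) (hs i) (ha j) (hb j) (hr j)]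
        simp only [CB1, CB2]
        split_ifs <;> ring
      · rw [hentry i j _ _ _ _ _ _ _ _ _ _ _ _ (hc i) (hd i) (hs i) (hc j) (hd j) (hs j)]
        simp only [CD1, CD2]
        split_ifs <;> ring
  rw [hchar, Polynomial.roots_multiset_prod_X_sub_C] at hroots
  exact hroots.symm
end

section
/- The nuclear norm of W, i.e. the sum of the square roots of the eigenvalues of W·Wᵀ, equals √(C_{A1} + N·C_{A2} + C_{D1} + N·C_{D2} + 2·√((C_{A1} + N·C_{A2})(C_{D1} + N·C_{D2}) − (C_{B1} + N·C_{B2})²)) + (N−1)·√(C_{A1} + C_{D1} + 2·|f1·m1 − g1·l1|). -/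
open Matrix

/-- The matrix `p • 1 + q • J`, where `J` is the all-ones matrix. -/
def scalarAddConst {R : Type*} [CommRing R] (n : Type*) [DecidableEq n] (p q : R) :
    Matrix n n R :=
  Matrix.of fun i j => (if i = j then p else 0) + q

theorem scalarAddConst_sub {R : Type*} [CommRing R] {n : Type*} [DecidableEq n] (p q r s : R) :
    scalarAddConst n p q - scalarAddConst n r s = scalarAddConst n (p - r) (q - s) := by
  ext i j
  simp only [scalarAddConst, Matrix.sub_apply, of_apply]
  split_ifs <;> ring

section ScalarAddConst

variable {R : Type*} [CommRing R] {n : Type*} [Fintype n] [DecidableEq n]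

theorem scalarAddConst_mul (p q r s : R) :
    scalarAddConst n p q * scalarAddConst n r s =
      scalarAddConst n (p * r) (p * s + q * r + Fintype.card n * (q * s)) := by
  ext i j
  simp only [scalarAddConst, mul_apply, of_apply, add_mul, mul_add, Finset.sum_add_distrib,
    ite_mul, mul_ite, zero_mul, mul_zero, Finset.sum_ite_eq, Finset.sum_ite_eq', Finset.mem_univ,
    if_true, Finset.sum_const, Finset.card_univ, nsmul_eq_mul]
  ring

theorem det_scalarAddConst [Nonempty n] (p q : R) :
    (scalarAddConst n p q).det = p ^ (Fintype.card n - 1) * (p + Fintype.card n * q) := by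
  have h := eval_charpoly (vecMulVec (fun _ : n => -q) (fun _ : n => (1 : R))) p
  have hM : scalar n p - vecMulVec (fun _ : n => -q) (fun _ : n => (1 : R)) =
      scalarAddConst n p q := by
    ext i j
    simp [scalarAddConst, vecMulVec_apply, diagonal_apply]
  obtain ⟨k, hk⟩ := Nat.exists_eq_succ_of_ne_zero (Fintype.card_ne_zero (α := n))
  rw [hM, charpoly_vecMulVec] at h
  rw [← h, hk]
  simp [dotProduct, hk, pow_succ]
  ring

theorem det_fromBlocks_of_commute [IsDomain R] (A B C D : Matrix n n R) (h : Commute C D)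
    (hD : D.det ≠ 0) : (fromBlocks A B C D).det = (A * D - B * C).det := by
  have hmul : fromBlocks A B C D * fromBlocks D 0 (-C) 1 =
      fromBlocks (A * D - B * C) B 0 D := by
    simp [fromBlocks_multiply, h.eq, sub_eq_add_neg]
  have hdet := congrArg det hmul
  rw [det_mul, det_fromBlocks_zero₁₂, det_fromBlocks_zero₂₁, det_one, mul_one] at hdet
  exact mul_right_cancel₀ hD hdet

open Polynomial in
theorem charmatrix_scalarAddConst (p q : R) :
    charmatrix (scalarAddConst n p q) = scalarAddConst n (X - C p) (-C q) := by
  ext i j : 1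
  by_cases h : i = j
  · subst h
    simp [scalarAddConst]
    ring
  · simp [scalarAddConst, h]

open Polynomial in
theorem charpoly_fromBlocks_scalarAddConst [IsDomain R] [Nonempty n] (a₁ a₂ b₁ b₂ d₁ d₂ : R) :
    (fromBlocks (scalarAddConst n a₁ a₂) (scalarAddConst n b₁ b₂)
      (scalarAddConst n b₁ b₂) (scalarAddConst n d₁ d₂)).charpoly =
    ((X - C a₁) * (X - C d₁) - C b₁ ^ 2) ^ (Fintype.card n - 1) *
      ((X - C (a₁ + Fintype.card n * a₂)) * (X - C (d₁ + Fintype.card n * d₂)) -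
        C (b₁ + Fintype.card n * b₂) ^ 2) := by
  have hB : -(scalarAddConst n b₁ b₂).map C = scalarAddConst n (-C b₁) (-C b₂) := by
    ext i j : 1
    by_cases h : i = j
    · simp [scalarAddConst, h]
      ring
    · simp [scalarAddConst, h]
  have hD : (charmatrix (scalarAddConst n d₁ d₂)).det ≠ 0 := (charpoly_monic _).ne_zero
  rw [charmatrix_scalarAddConst] at hD
  rw [charpoly, charmatrix_fromBlocks, hB, charmatrix_scalarAddConst, charmatrix_scalarAddConst,
    det_fromBlocks_of_commute _ _ _ _ _ hD, scalarAddConst_mul, scalarAddConst_mul,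
    scalarAddConst_sub, det_scalarAddConst]
  · congr 1
    · ring
    · simp only [map_add, map_mul, map_natCast]
      ring
  · rw [Commute, SemiconjBy, scalarAddConst_mul, scalarAddConst_mul]
    congr 1 <;> ring

end ScalarAddConst

open Polynomial in
theorem exists_factorization_sqrt_add_sqrt (a b d : ℝ) (ha : 0 ≤ a) (hd : 0 ≤ d)
    (h : 0 ≤ a * d - b ^ 2) :
    ∃ r s : ℝ, (X - C a) * (X - C d) - C b ^ 2 = (X - C r) * (X - C s) ∧
      √r + √s = √(a + d + 2 * √(a * d - b ^ 2)) := by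
  set t := √((a - d) ^ 2 + 4 * b ^ 2)
  have ht2 : t ^ 2 = (a - d) ^ 2 + 4 * b ^ 2 := Real.sq_sqrt (by positivity)
  have ht0 : 0 ≤ t := Real.sqrt_nonneg _
  have hts : t ≤ a + d := abs_le_of_sq_le_sq' (by nlinarith) (by linarith) |>.2
  have hsum : (a + d + t) / 2 + (a + d - t) / 2 = a + d := by ring
  have hprod : (a + d + t) / 2 * ((a + d - t) / 2) = a * d - b ^ 2 := by linear_combination -ht2 / 4
  have hr : 0 ≤ (a + d + t) / 2 := by linarith
  have hs : 0 ≤ (a + d - t) / 2 := by linarith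
  generalize (a + d + t) / 2 = r at *
  generalize (a + d - t) / 2 = s at *
  refine ⟨r, s, ?_, ?_⟩
  · have hsum' : (C r + C s : ℝ[X]) = C a + C d := by rw [← C_add, hsum, C_add]
    have hprod' : (C r * C s : ℝ[X]) = C a * C d - C b ^ 2 := by
      rw [← C_mul, hprod, C_sub, C_mul, C_pow]
    linear_combination X * hsum' - hprod'
  · rw [← hsum, ← hprod, Real.sqrt_mul hr, eq_comm,
      Real.sqrt_eq_iff_mul_self_eq (by positivity) (by positivity)]
    linear_combination -Real.sq_sqrt hr - Real.sq_sqrt hs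

open Polynomial in
theorem sum_sqrt_eigenvalues_of_charpoly_eq {n : Type*} [Fintype n] [DecidableEq n]
    {A : Matrix n n ℝ} (hA : A.IsHermitian) {r s u v : ℝ} {k : ℕ}
    (h : A.charpoly = ((X - C r) * (X - C s)) ^ k * ((X - C u) * (X - C v))) :
    ∑ i, √(hA.eigenvalues i) = √u + √v + k * (√r + √s) := by
  have hroots := hA.roots_charpoly_eq_eigenvalues
  have h1 : ((X - C r) * (X - C s)) ≠ 0 := mul_ne_zero (X_sub_C_ne_zero r) (X_sub_C_ne_zero s)
  have h2 : ((X - C u) * (X - C v)) ≠ 0 := mul_ne_zero (X_sub_C_ne_zero u) (X_sub_C_ne_zero v)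
  rw [h, roots_mul (mul_ne_zero (pow_ne_zero k h1) h2), roots_pow, roots_mul h1, roots_mul h2]
    at hroots
  have := congrArg (fun m : Multiset ℝ => (m.map Real.sqrt).sum) hroots
  simp [Multiset.map_map, Multiset.map_nsmul, Multiset.sum_nsmul] at this
  rw [← this]
  ring

/-- The two row blocks together enumerate `Fin (2 * N)`. -/
def rowEquiv (N : ℕ) : Fin N ⊕ Fin N ≃ Fin (2 * N) :=
  finSumFinEquiv.trans (finCongr (two_mul N).symm)

theorem rowEquiv_inl (N : ℕ) (i : Fin N) : rowEquiv N (Sum.inl i) = aRow N i := rfl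

theorem rowEquiv_inr (N : ℕ) (i : Fin N) : rowEquiv N (Sum.inr i) = bRow N i := rfl

theorem sum_univ_col {M : Type*} [AddCommMonoid M] (N : ℕ) (f : Fin (2 * N + 1) → M) :
    ∑ k, f k = ∑ j, f (aCol N j) + ∑ j, f (bCol N j) + f (rCol N) := by
  rw [Fin.sum_univ_castSucc, ← (rowEquiv N).sum_comp, Fintype.sum_sum_type]
  rfl

theorem sum_ite_add_mul_ite_add_s6 {R : Type*} [CommRing R] {n : Type*} [Fintype n] [DecidableEq n]
    (p q r s : R) (i j : n) :
    ∑ k, ((if i = k then p else 0) + q) * ((if j = k then r else 0) + s) =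
      (if i = j then p * r else 0) + (p * s + q * r + Fintype.card n * (q * s)) := by
  have h := congrFun₂ (scalarAddConst_mul (n := n) p q r s) i j
  simpa only [scalarAddConst, mul_apply, of_apply, eq_comm (b := j)] using h

/-- The nuclear norm of the symmetric block matrix `W`,
i.e. the sum of the square roots of the eigenvalues of `W·Wᵀ`, equals the
closed-form expression in the constants `C_{A1}, C_{A2}, C_{D1}, C_{D2},
C_{B1}, C_{B2}`. -/
theorem nuclear_norm_of_block_matrix (N : ℕ) (hN : 2 ≤ N)
    (f1 f2 g1 g2 l1 l2 m1 m2 β α : ℝ)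
    (W : Matrix (Fin (2 * N)) (Fin (2 * N + 1)) ℝ)
    (hW : ∀ i j : Fin N,
      W (aRow N i) (aCol N j) = (if i = j then f1 else 0) + f2 ∧
      W (aRow N i) (bCol N j) = (if i = j then g1 else 0) + g2 ∧
      W (aRow N i) (rCol N) = β ∧
      W (bRow N i) (aCol N j) = (if i = j then l1 else 0) + l2 ∧
      W (bRow N i) (bCol N j) = (if i = j then m1 else 0) + m2 ∧
      W (bRow N i) (rCol N) = α)
    (hHerm : (W * Wᵀ).IsHermitian) :
    ∑ i, Real.sqrt (hHerm.eigenvalues i) =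
      (let CA1 : ℝ := f1 ^ 2 + g1 ^ 2
       let CA2 : ℝ := 2 * f1 * f2 + N * f2 ^ 2 + 2 * g1 * g2 + N * g2 ^ 2 + β ^ 2
       let CD1 : ℝ := l1 ^ 2 + m1 ^ 2
       let CD2 : ℝ := 2 * l1 * l2 + N * l2 ^ 2 + 2 * m1 * m2 + N * m2 ^ 2 + α ^ 2
       let CB1 : ℝ := f1 * l1 + g1 * m1
       let CB2 : ℝ := f1 * l2 + f2 * l1 + N * f2 * l2 + g1 * m2 + g2 * m1 + N * g2 * m2 + β * α
       Real.sqrt (CA1 + N * CA2 + CD1 + N * CD2 +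
           2 * Real.sqrt ((CA1 + N * CA2) * (CD1 + N * CD2) - (CB1 + N * CB2) ^ 2)) +
         ((N : ℝ) - 1) * Real.sqrt (CA1 + CD1 + 2 * |f1 * m1 - g1 * l1|)) := by
  have : NeZero N := ⟨by omega⟩
  have hblocks : (reindex (rowEquiv N).symm (rowEquiv N).symm) (W * Wᵀ) =
      fromBlocks
        (scalarAddConst (Fin N) (f1 ^ 2 + g1 ^ 2)
          (2 * f1 * f2 + N * f2 ^ 2 + 2 * g1 * g2 + N * g2 ^ 2 + β ^ 2))
        (scalarAddConst (Fin N) (f1 * l1 + g1 * m1)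
          (f1 * l2 + f2 * l1 + N * f2 * l2 + g1 * m2 + g2 * m1 + N * g2 * m2 + β * α))
        (scalarAddConst (Fin N) (f1 * l1 + g1 * m1)
          (f1 * l2 + f2 * l1 + N * f2 * l2 + g1 * m2 + g2 * m1 + N * g2 * m2 + β * α))
        (scalarAddConst (Fin N) (l1 ^ 2 + m1 ^ 2)
          (2 * l1 * l2 + N * l2 ^ 2 + 2 * m1 * m2 + N * m2 ^ 2 + α ^ 2)) := by
    have ha := fun i j => (hW i j).1
    have hb := fun i j => (hW i j).2.1
    have hr := fun i => (hW i i).2.2.1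
    have ha' := fun i j => (hW i j).2.2.2.1
    have hb' := fun i j => (hW i j).2.2.2.2.1
    have hr' := fun i => (hW i i).2.2.2.2.2
    ext (i | i) (j | j) <;>
      simp only [reindex_apply, submatrix_apply, Equiv.symm_symm, rowEquiv_inl, rowEquiv_inr,
        fromBlocks_apply₁₁, fromBlocks_apply₁₂, fromBlocks_apply₂₁, fromBlocks_apply₂₂,
        mul_apply, transpose_apply, sum_univ_col, ha, hb, hr, ha', hb', hr',
        sum_ite_add_mul_ite_add_s6, scalarAddConst, of_apply, Fintype.card_fin] <;>
      split_ifs <;> ring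
  have hchar := charpoly_reindex (rowEquiv N).symm (W * Wᵀ)
  rw [hblocks, charpoly_fromBlocks_scalarAddConst, Fintype.card_fin] at hchar
  have hdet : (f1 ^ 2 + g1 ^ 2) * (l1 ^ 2 + m1 ^ 2) - (f1 * l1 + g1 * m1) ^ 2 =
      (f1 * m1 - g1 * l1) ^ 2 := by ring
  obtain ⟨r, s, hrs, hrs_sqrt⟩ := exists_factorization_sqrt_add_sqrt
    (f1 ^ 2 + g1 ^ 2) (f1 * l1 + g1 * m1) (l1 ^ 2 + m1 ^ 2) (by positivity) (by positivity)
    (hdet ▸ sq_nonneg _)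
  obtain ⟨u, v, huv, huv_sqrt⟩ := exists_factorization_sqrt_add_sqrt
    (f1 ^ 2 + g1 ^ 2 + N * (2 * f1 * f2 + N * f2 ^ 2 + 2 * g1 * g2 + N * g2 ^ 2 + β ^ 2))
    (f1 * l1 + g1 * m1 +
      N * (f1 * l2 + f2 * l1 + N * f2 * l2 + g1 * m2 + g2 * m1 + N * g2 * m2 + β * α))
    (l1 ^ 2 + m1 ^ 2 + N * (2 * l1 * l2 + N * l2 ^ 2 + 2 * m1 * m2 + N * m2 ^ 2 + α ^ 2))
    (by
      have : 0 ≤ (f1 + N * f2) ^ 2 + (g1 + N * g2) ^ 2 + N * β ^ 2 := by positivity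
      linarith)
    (by
      have : 0 ≤ (l1 + N * l2) ^ 2 + (m1 + N * m2) ^ 2 + N * α ^ 2 := by positivity
      linarith)
    (by
      have : 0 ≤ ((f1 + N * f2) * (m1 + N * m2) - (g1 + N * g2) * (l1 + N * l2)) ^ 2 +
          N * ((f1 + N * f2) * α - β * (l1 + N * l2)) ^ 2 +
          N * ((g1 + N * g2) * α - β * (m1 + N * m2)) ^ 2 := by positivity
      linarith)
  rw [hrs, huv] at hchar
  rw [hdet, Real.sqrt_sq_eq_abs] at hrs_sqrt
  rw [sum_sqrt_eigenvalues_of_charpoly_eq hHerm hchar.symm, hrs_sqrt, huv_sqrt,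
    Nat.cast_sub (by omega), Nat.cast_one]
  simp only [add_assoc]
end

section
/- For any integer N ≥ 1 and any reals f1, f2, g1, g2, l1, l2, m1, m2, β, α: (i) (C_{A1} + N·C_{A2})·(C_{D1} + N·C_{D2}) ≥ (C_{B1} + N·C_{B2})², and (ii) √(C_{A1} + N·C_{A2} + C_{D1} + N·C_{D2} + 2·√((C_{A1} + N·C_{A2})(C_{D1} + N·C_{D2}) − (C_{B1} + N·C_{B2})²)) ≥ √(((f1 + N·f2 − l1 − N·l2)² + (m1 + N·m2 − g1 − N·g2)² + N·(β − α)²)/2), with equality in (ii) if and only if f1 + N·f2 + l1 + N·l2 = 0, g1 + N·g2 + m1 + N·m2 = 0, and β + α = 0. -/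
/-- Lagrange's identity for `(F, G, √n b)` and `(L, M, √n a)`. -/
lemma weighted_lagrange_identity (n F G b L M a : ℝ) :
    (F ^ 2 + G ^ 2 + n * b ^ 2) * (L ^ 2 + M ^ 2 + n * a ^ 2) -
        (F * L + G * M + n * (b * a)) ^ 2 =
      (F * M - G * L) ^ 2 + n * (F * a - b * L) ^ 2 + n * (G * a - b * M) ^ 2 := by
  ring

/-- For any integer `N ≥ 1` and any reals, with
`C_{A1} = f1² + g1²`, `C_{A2} = 2f1f2 + Nf2² + 2g1g2 + Ng2² + β²`,
`C_{D1} = l1² + m1²`, `C_{D2} = 2l1l2 + Nl2² + 2m1m2 + Nm2² + α²`,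
`C_{B1} = f1l1 + g1m1`,
`C_{B2} = f1l2 + f2l1 + Nf2l2 + g1m2 + g2m1 + Ng2m2 + βα`:
(i) `(C_{A1} + N·C_{A2})·(C_{D1} + N·C_{D2}) ≥ (C_{B1} + N·C_{B2})²`;
(ii) the square-root inequality holds, with equality if and only if
`f1 + Nf2 + l1 + Nl2 = 0`, `g1 + Ng2 + m1 + Nm2 = 0` and `β + α = 0`. -/
theorem cauchy_schwarz_block (N : ℕ) (hN : 1 ≤ N)
    (f1 f2 g1 g2 l1 l2 m1 m2 β α : ℝ) :
    (let CA1 : ℝ := f1 ^ 2 + g1 ^ 2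
     let CA2 : ℝ := 2 * f1 * f2 + N * f2 ^ 2 + 2 * g1 * g2 + N * g2 ^ 2 + β ^ 2
     let CD1 : ℝ := l1 ^ 2 + m1 ^ 2
     let CD2 : ℝ := 2 * l1 * l2 + N * l2 ^ 2 + 2 * m1 * m2 + N * m2 ^ 2 + α ^ 2
     let CB1 : ℝ := f1 * l1 + g1 * m1
     let CB2 : ℝ := f1 * l2 + f2 * l1 + N * f2 * l2 + g1 * m2 + g2 * m1 + N * g2 * m2 + β * α
     (CB1 + N * CB2) ^ 2 ≤ (CA1 + N * CA2) * (CD1 + N * CD2) ∧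
     Real.sqrt (((f1 + N * f2 - l1 - N * l2) ^ 2 + (m1 + N * m2 - g1 - N * g2) ^ 2 +
           N * (β - α) ^ 2) / 2) ≤
       Real.sqrt (CA1 + N * CA2 + CD1 + N * CD2 +
         2 * Real.sqrt ((CA1 + N * CA2) * (CD1 + N * CD2) - (CB1 + N * CB2) ^ 2)) ∧
     (Real.sqrt (CA1 + N * CA2 + CD1 + N * CD2 +
           2 * Real.sqrt ((CA1 + N * CA2) * (CD1 + N * CD2) - (CB1 + N * CB2) ^ 2)) =
         Real.sqrt (((f1 + N * f2 - l1 - N * l2) ^ 2 + (m1 + N * m2 - g1 - N * g2) ^ 2 +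
           N * (β - α) ^ 2) / 2) ↔
       f1 + N * f2 + l1 + N * l2 = 0 ∧ g1 + N * g2 + m1 + N * m2 = 0 ∧ β + α = 0)) := by
  intro CA1 CA2 CD1 CD2 CB1 CB2
  have hn : (0 : ℝ) < N := by exact_mod_cast hN
  set F := f1 + N * f2 with hF
  set G := g1 + N * g2 with hG
  set L := l1 + N * l2 with hL
  set M := m1 + N * m2 with hM
  have hA : CA1 + N * CA2 = F ^ 2 + G ^ 2 + N * β ^ 2 := by
    simp only [CA1, CA2, hF, hG]; ring
  have hD : CD1 + N * CD2 = L ^ 2 + M ^ 2 + N * α ^ 2 := by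
    simp only [CD1, CD2, hL, hM]; ring
  have hB : CB1 + N * CB2 = F * L + G * M + N * (β * α) := by
    simp only [CB1, CB2, hF, hG, hL, hM]; ring
  have hdiff : (F - l1 - N * l2) ^ 2 + (M - g1 - N * g2) ^ 2 + N * (β - α) ^ 2 =
      (F - L) ^ 2 + (M - G) ^ 2 + N * (β - α) ^ 2 := by
    rw [hL, hG]; ring
  have hsumF : F + l1 + N * l2 = F + L := by rw [hL]; ring
  have hsumG : G + m1 + N * m2 = G + M := by rw [hM]; ring
  rw [add_assoc (CA1 + N * CA2), hA, hD, hB, hdiff, hsumF, hsumG]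
  have hgram := weighted_lagrange_identity N F G β L M α
  set S := √((F ^ 2 + G ^ 2 + N * β ^ 2) * (L ^ 2 + M ^ 2 + N * α ^ 2) -
    (F * L + G * M + N * (β * α)) ^ 2) with hS
  have hS0 : 0 ≤ S := Real.sqrt_nonneg _
  have hsplit : F ^ 2 + G ^ 2 + N * β ^ 2 + (L ^ 2 + M ^ 2 + N * α ^ 2) + 2 * S =
      ((F - L) ^ 2 + (M - G) ^ 2 + N * (β - α) ^ 2) / 2 +
        (((F + L) ^ 2 + (G + M) ^ 2 + N * (β + α) ^ 2) / 2 + 2 * S) := by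
    ring
  have hF0 := sq_nonneg (F + L)
  have hG0 := sq_nonneg (G + M)
  have hβ0 : 0 ≤ N * (β + α) ^ 2 := by positivity
  refine ⟨?_, ?_, ?_⟩
  · rw [← sub_nonneg, hgram]
    positivity
  · apply Real.sqrt_le_sqrt
    linarith
  · rw [Real.sqrt_inj (by positivity) (by positivity), hsplit, add_eq_left]
    constructor
    · intro h
      have hβ : N * (β + α) ^ 2 = 0 := by linarith
      exact ⟨pow_eq_zero_iff two_ne_zero |>.mp (by linarith),
        pow_eq_zero_iff two_ne_zero |>.mp (by linarith),
        pow_eq_zero_iff two_ne_zero |>.mp ((mul_eq_zero.mp hβ).resolve_left hn.ne')⟩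
    · rintro ⟨h1, h2, h3⟩
      have hS_zero : S = 0 := by
        rw [hS, hgram, eq_neg_of_add_eq_zero_right h1, eq_neg_of_add_eq_zero_right h2,
          eq_neg_of_add_eq_zero_right h3]
        ring_nf
        exact Real.sqrt_zero
      rw [h1, h2, h3, hS_zero]
      ring
end
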